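/- There exists a constant C > 0 such that for every k_F ≥ 2 and every k ∈ ℤ³ with 0 < |k| < 2k_F, one has D₂(k, k_F) ≤ C k_F^{2/3} (ln k_F) |k|⁴. -/

import Mathlib

open scoped BigOperators

/-- The Euclidean norm of a lattice point `k ∈ ℤ³`. -/
noncomputable def znorm (k : Fin 3 → ℤ) : ℝ := Real.sqrt (∑ i, ((k i : ℝ))^2)

/-- The lune set `L(k) = {p ∈ ℤ³ : |p| > k_F and |p − k| ≤ k_F}`. -/
def lune (kF : ℝ) (k : Fin 3 → ℤ) : Set (Fin 3 → ℤ) :=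
  {p | kF < znorm p ∧ znorm (p - k) ≤ kF}

/- The resolvent sum `D_α(k, k_F) = Σ_{p ∈ L(k)} (|p|² − |p − k|²)^{−α}`
(a finite sum, written as a `tsum` of the indicator; the power is a real power). -/
open Classical in
noncomputable def Dsum (α kF : ℝ) (k : Fin 3 → ℤ) : ℝ :=
  ∑' p : Fin 3 → ℤ,
    if p ∈ lune kF k then ((znorm p) ^ 2 - (znorm (p - k)) ^ 2) ^ (-α) else 0

lemma exists_orthogonal_coordinates (k : Fin 3 → ℝ) (hk : 0 < ∑ i, k i ^ 2) :
    ∃ e f : Fin 3 → ℝ, ∀ p : Fin 3 → ℝ,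
      ∑ i, p i ^ 2 = (∑ i, p i * e i) ^ 2 + (∑ i, p i * f i) ^ 2
        + (∑ i, p i * k i) ^ 2 / ∑ i, k i ^ 2 := by
  simp only [Fin.sum_univ_three] at hk ⊢
  set a := k 0
  set b := k 1
  set c := k 2
  by_cases h : a ^ 2 + b ^ 2 = 0
  · have ha : a = 0 := by nlinarith [sq_nonneg a, sq_nonneg b]
    have hb : b = 0 := by nlinarith [sq_nonneg a, sq_nonneg b]
    refine ⟨![1, 0, 0], ![0, 1, 0], fun p => ?_⟩
    rw [ha, hb] at hk ⊢
    have hc : c ^ 2 ≠ 0 := by intro h0; simp [h0] at hk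
    have hc' : c ≠ 0 := fun h0 => hc (by rw [h0]; ring)
    simp
    field_simp
  · have hs : 0 < a ^ 2 + b ^ 2 := lt_of_le_of_ne (by positivity) (Ne.symm h)
    set s := √(a ^ 2 + b ^ 2) with hs_def
    set r := √(a ^ 2 + b ^ 2 + c ^ 2) with hr_def
    have hss : s ^ 2 = a ^ 2 + b ^ 2 := Real.sq_sqrt hs.le
    have hrr : r ^ 2 = a ^ 2 + b ^ 2 + c ^ 2 := Real.sq_sqrt hk.le
    have hs0 : 0 < s := Real.sqrt_pos.2 hs
    have hr0 : 0 < r := Real.sqrt_pos.2 hk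
    refine ⟨![-b / s, a / s, 0], ![-(a * c) / (s * r), -(b * c) / (s * r), s ^ 2 / (s * r)],
      fun p => ?_⟩
    have hx : (p 0 * (-b / s) + p 1 * (a / s) + p 2 * 0) ^ 2
        = (p 1 * a - p 0 * b) ^ 2 / s ^ 2 := by field_simp; ring
    have hy : (p 0 * (-(a * c) / (s * r)) + p 1 * (-(b * c) / (s * r))
        + p 2 * (s ^ 2 / (s * r))) ^ 2
        = (p 2 * s ^ 2 - p 0 * (a * c) - p 1 * (b * c)) ^ 2 / (s ^ 2 * r ^ 2) := by
      field_simp; ring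
    simp only [Matrix.cons_val_zero, Matrix.cons_val_one, Matrix.cons_val]
    rw [hx, hy, hss, hrr]
    field_simp
    ring

/-- Three distinct points of a circle with integral squared distances `A`, `B`, `C` satisfy
`A * B * C ≥ R ^ 2`: this is `abc = 4 R Δ`, the number `16 Δ ^ 2` being a positive integer. -/
lemma sq_radius_le_prod_sq_dist {u₁ v₁ u₂ v₂ u₃ v₃ Q : ℝ} {A B C : ℤ}
    (h₁ : u₁ ^ 2 + v₁ ^ 2 = Q) (h₂ : u₂ ^ 2 + v₂ ^ 2 = Q) (h₃ : u₃ ^ 2 + v₃ ^ 2 = Q)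
    (hA : (A : ℝ) = (u₁ - u₂) ^ 2 + (v₁ - v₂) ^ 2)
    (hB : (B : ℝ) = (u₁ - u₃) ^ 2 + (v₁ - v₃) ^ 2)
    (hC : (C : ℝ) = (u₂ - u₃) ^ 2 + (v₂ - v₃) ^ 2)
    (hA0 : 0 < A) (hB0 : 0 < B) (hC0 : 0 < C) :
    Q ≤ A * B * C := by
  have key : Q * ((4 * A * B - (A + B - C) ^ 2 : ℤ) : ℝ) = A * B * C := by
    push_cast
    set t := u₁ * u₂ + v₁ * v₂ with ht
    set w := u₁ * u₃ + v₁ * v₃ with hw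
    set z := u₂ * u₃ + v₂ * v₃ with hz
    have hA' : (A : ℝ) = 2 * (Q - t) := by rw [hA]; linear_combination h₁ + h₂
    have hB' : (B : ℝ) = 2 * (Q - w) := by rw [hB]; linear_combination h₁ + h₃
    have hC' : (C : ℝ) = 2 * (Q - z) := by rw [hC]; linear_combination h₂ + h₃
    -- the Gram determinant of three vectors in the plane vanishes
    have hG : Q ^ 3 + 2 * t * w * z - Q * t ^ 2 - Q * w ^ 2 - Q * z ^ 2 = 0 := by
      have : (u₁ ^ 2 + v₁ ^ 2) * (u₂ ^ 2 + v₂ ^ 2) * (u₃ ^ 2 + v₃ ^ 2) + 2 * t * w * z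
          - (u₃ ^ 2 + v₃ ^ 2) * t ^ 2 - (u₂ ^ 2 + v₂ ^ 2) * w ^ 2
          - (u₁ ^ 2 + v₁ ^ 2) * z ^ 2 = 0 := by
        rw [ht, hw, hz]; ring
      rw [h₁, h₂, h₃] at this
      linear_combination this
    rw [hA', hB', hC']
    linear_combination 4 * hG
  have hpos : (0 : ℝ) < A * B * C := by
    have hA1 : (0 : ℝ) < A := by exact_mod_cast hA0
    have hB1 : (0 : ℝ) < B := by exact_mod_cast hB0
    have hC1 : (0 : ℝ) < C := by exact_mod_cast hC0
    positivity
  have hQ : 0 ≤ Q := by rw [← h₁]; positivity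
  have hD : (0 : ℝ) < ((4 * A * B - (A + B - C) ^ 2 : ℤ) : ℝ) := by
    by_contra hcon
    nlinarith [mul_nonneg hQ (neg_nonneg.2 (not_lt.1 hcon))]
  have hD1 : (1 : ℝ) ≤ ((4 * A * B - (A + B - C) ^ 2 : ℤ) : ℝ) := by
    have : 0 < (4 * A * B - (A + B - C) ^ 2 : ℤ) := by exact_mod_cast hD
    exact_mod_cast this
  rw [← key]
  exact le_mul_of_one_le_right hQ hD1

lemma dist_sq_le_of_polar {R θ φ : ℝ} :
    (R * Real.cos θ - R * Real.cos φ) ^ 2 + (R * Real.sin θ - R * Real.sin φ) ^ 2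
      ≤ R ^ 2 * (θ - φ) ^ 2 := by
  have h := Real.one_sub_sq_div_two_le_cos (x := θ - φ)
  have e : (R * Real.cos θ - R * Real.cos φ) ^ 2 + (R * Real.sin θ - R * Real.sin φ) ^ 2
      = R ^ 2 * (2 - 2 * Real.cos (θ - φ)) := by
    rw [Real.cos_sub]
    linear_combination R ^ 2 * Real.sin_sq_add_cos_sq θ + R ^ 2 * Real.sin_sq_add_cos_sq φ
  rw [e]
  exact mul_le_mul_of_nonneg_left (by linarith) (sq_nonneg R)

/-- A plane section of the sphere `|p| ^ 2 = n` contains `O(n ^ (1 / 3))` lattice points. -/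
lemma card_plane_section_sphere_le (k : Fin 3 → ℤ) (hk : 0 < ∑ i, k i ^ 2) (n c : ℤ) (T : ℕ)
    (hT : 0 < T) (hn : n < (T : ℤ) ^ 3) (S : Finset (Fin 3 → ℤ))
    (hS : ∀ p ∈ S, ∑ i, p i ^ 2 = n ∧ ∑ i, p i * k i = c) :
    S.card ≤ 18 * T := by
  have hkR : (0 : ℝ) < ∑ i, ((k i : ℤ) : ℝ) ^ 2 := by exact_mod_cast hk
  obtain ⟨e, f, hef⟩ := exists_orthogonal_coordinates (fun i => (k i : ℝ)) hkR
  set u : (Fin 3 → ℤ) → ℝ := fun p => ∑ i, (p i : ℝ) * e i with hu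
  set v : (Fin 3 → ℤ) → ℝ := fun p => ∑ i, (p i : ℝ) * f i with hv
  set Q : ℝ := n - (c : ℝ) ^ 2 / ∑ i, ((k i : ℤ) : ℝ) ^ 2 with hQ
  have hcirc : ∀ p ∈ S, u p ^ 2 + v p ^ 2 = Q := by
    intro p hp
    obtain ⟨h1, h2⟩ := hS p hp
    have h := hef (fun i => (p i : ℝ))
    have h1' : ∑ i, (p i : ℝ) ^ 2 = n := by exact_mod_cast h1
    have h2' : ∑ i, (p i : ℝ) * k i = c := by exact_mod_cast h2
    rw [h1', h2'] at h
    simp only [hu, hv, hQ]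
    linarith
  have hdist : ∀ p ∈ S, ∀ q ∈ S, ((∑ i, (p i - q i) ^ 2 : ℤ) : ℝ)
      = (u p - u q) ^ 2 + (v p - v q) ^ 2 := by
    intro p hp q hq
    have h := hef (fun i => (p i : ℝ) - q i)
    have h0 : ∑ i, ((p i : ℝ) - q i) * k i = 0 := by
      have h1 : ∑ i, (p i : ℝ) * k i = c := by exact_mod_cast (hS p hp).2
      have h2 : ∑ i, (q i : ℝ) * k i = c := by exact_mod_cast (hS q hq).2
      simp only [sub_mul, Finset.sum_sub_distrib, h1, h2, sub_self]
    rw [h0] at h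
    push_cast
    rw [h]
    simp only [hu, hv, ← Finset.sum_sub_distrib, sub_mul]
    ring
  have hpos : ∀ p q : Fin 3 → ℤ, p ≠ q → 0 < ∑ i, (p i - q i) ^ 2 := by
    intro p q hpq
    obtain ⟨i, hi⟩ := Function.ne_iff.1 hpq
    exact Finset.sum_pos' (fun _ _ => sq_nonneg _)
      ⟨i, Finset.mem_univ i, by have := sub_ne_zero.2 hi; positivity⟩
  have hQn : Q ≤ n := sub_le_self _ (by positivity)
  have hQT : Q < (T : ℝ) ^ 3 := hQn.trans_lt (by exact_mod_cast hn)
  have hTR : (0 : ℝ) < T := by exact_mod_cast hT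
  set θ : (Fin 3 → ℤ) → ℝ := fun p => Complex.arg ⟨u p, v p⟩ with hθ
  have hpolar : ∀ p ∈ S, u p = √Q * Real.cos (θ p) ∧ v p = √Q * Real.sin (θ p) := by
    intro p hp
    have hnorm : ‖(⟨u p, v p⟩ : ℂ)‖ = √Q := by
      rw [← hcirc p hp, Complex.norm_def, Complex.normSq_mk]; congr 1; ring
    rw [← hnorm]
    exact ⟨(Complex.norm_mul_cos_arg ⟨u p, v p⟩).symm, (Complex.norm_mul_sin_arg ⟨u p, v p⟩).symm⟩
  have hmaps : ∀ p ∈ S, ⌊T * θ p⌋ ∈ Finset.Icc (-(4 * T : ℤ)) (4 * T) := by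
    intro p _
    have h1 : θ p ≤ Real.pi := Complex.arg_le_pi _
    have h2 : -Real.pi < θ p := Complex.neg_pi_lt_arg _
    have h3 := Real.pi_lt_four
    rw [Finset.mem_Icc]
    constructor
    · rw [Int.le_floor]; push_cast; nlinarith
    · have : (⌊T * θ p⌋ : ℝ) ≤ 4 * T := (Int.floor_le _).trans (by nlinarith)
      exact_mod_cast this
  have hfib : ∀ b ∈ Finset.Icc (-(4 * T : ℤ)) (4 * T),
      (S.filter (fun p => ⌊T * θ p⌋ = b)).card ≤ 2 := by
    intro b _
    by_contra hcon
    obtain ⟨p, hp, q, hq, r, hr, hpq, hpr, hqr⟩ := Finset.two_lt_card.1 (not_le.1 hcon)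
    rw [Finset.mem_filter] at hp hq hr
    have hQ0 : 0 ≤ Q := by rw [← hcirc p hp.1]; positivity
    have hshort : ∀ x y, (x ∈ S ∧ ⌊T * θ x⌋ = b) → (y ∈ S ∧ ⌊T * θ y⌋ = b) →
        ((∑ i, (x i - y i) ^ 2 : ℤ) : ℝ) ≤ Q / (T : ℝ) ^ 2 := by
      intro x y hx hy
      rw [hdist x hx.1 y hy.1, (hpolar x hx.1).1, (hpolar x hx.1).2, (hpolar y hy.1).1,
        (hpolar y hy.1).2]
      refine dist_sq_le_of_polar.trans ?_
      rw [Real.sq_sqrt hQ0, le_div_iff₀ (by positivity), mul_assoc]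
      have habs := Int.abs_sub_lt_one_of_floor_eq_floor (hx.2.trans hy.2.symm)
      have : (θ x - θ y) ^ 2 * (T : ℝ) ^ 2 ≤ 1 := by
        rw [← mul_pow, ← sq_abs]
        have e : (θ x - θ y) * T = T * θ x - T * θ y := by ring
        rw [e]
        exact pow_le_one₀ (abs_nonneg _) habs.le
      nlinarith
    have hA := hshort p q hp hq
    have hB := hshort p r hp hr
    have hC := hshort q r hq hr
    have hA0 := hpos p q hpq
    have hB0 := hpos p r hpr
    have hC0 := hpos q r hqr
    have hlow := sq_radius_le_prod_sq_dist (hcirc p hp.1) (hcirc q hq.1) (hcirc r hr.1)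
      (hdist p hp.1 q hq.1) (hdist p hp.1 r hr.1) (hdist q hq.1 r hr.1) hA0 hB0 hC0
    have hA0' : (0 : ℝ) < ((∑ i, (p i - q i) ^ 2 : ℤ) : ℝ) := by exact_mod_cast hA0
    have hB0' : (0 : ℝ) < ((∑ i, (p i - r i) ^ 2 : ℤ) : ℝ) := by exact_mod_cast hB0
    have hC0' : (0 : ℝ) < ((∑ i, (q i - r i) ^ 2 : ℤ) : ℝ) := by exact_mod_cast hC0
    have hQT0 : 0 < Q / (T : ℝ) ^ 2 := hA0'.trans_le hA
    have hQpos : 0 < Q := by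
      by_contra h
      have : Q = 0 := le_antisymm (not_lt.1 h) hQ0
      simp [this] at hQT0
    have hup : Q ≤ (Q / (T : ℝ) ^ 2) * (Q / (T : ℝ) ^ 2) * (Q / (T : ℝ) ^ 2) :=
      hlow.trans (by gcongr)
    have e : (Q / (T : ℝ) ^ 2) * (Q / (T : ℝ) ^ 2) * (Q / (T : ℝ) ^ 2)
        = Q * (Q / (T : ℝ) ^ 3) ^ 2 := by field_simp
    rw [e] at hup
    have hlt : Q / (T : ℝ) ^ 3 < 1 := (div_lt_one (by positivity)).2 hQT
    have hlt2 : (Q / (T : ℝ) ^ 3) ^ 2 < 1 := pow_lt_one₀ (by positivity) hlt two_ne_zero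
    nlinarith
  have hcard := Finset.card_le_mul_card_image_of_maps_to hmaps 2 hfib
  rw [Int.card_Icc] at hcard
  omega

lemma znorm_sq (p : Fin 3 → ℤ) : znorm p ^ 2 = ((∑ i, p i ^ 2 : ℤ) : ℝ) := by
  rw [znorm, Real.sq_sqrt (by positivity)]
  push_cast
  rfl

lemma znorm_eq_norm (p : Fin 3 → ℤ) : znorm p = ‖WithLp.toLp 2 (fun i => (p i : ℝ))‖ := by
  rw [znorm, EuclideanSpace.norm_eq]
  simp

lemma znorm_le_add (p k : Fin 3 → ℤ) : znorm p ≤ znorm (p - k) + znorm k := by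
  simp only [znorm_eq_norm]
  refine le_trans (le_of_eq ?_) (norm_add_le _ _)
  congr 1
  ext i
  simp

/-- The integer `|p| ^ 2 - |p - k| ^ 2`. -/
def energyGap (k p : Fin 3 → ℤ) : ℤ := ∑ i, p i ^ 2 - ∑ i, (p - k) i ^ 2

lemma cast_energyGap (k p : Fin 3 → ℤ) :
    (energyGap k p : ℝ) = znorm p ^ 2 - znorm (p - k) ^ 2 := by
  rw [znorm_sq, znorm_sq, energyGap]
  push_cast
  rfl

lemma two_mul_dot_eq (k p : Fin 3 → ℤ) :
    2 * ∑ i, p i * k i = energyGap k p + ∑ i, k i ^ 2 := by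
  simp only [energyGap, Fin.sum_univ_three, Pi.sub_apply]
  ring

lemma card_energyGap_fiber_le (kF : ℝ) (k : Fin 3 → ℤ) (hk : 0 < ∑ i, k i ^ 2) (T : ℕ)
    (hT : 0 < T) (S : Finset (Fin 3 → ℤ)) (hkF : 0 ≤ kF) (hS : ∀ p ∈ S, p ∈ lune kF k)
    (hST : ∀ p ∈ S, ∑ i, p i ^ 2 < (T : ℤ) ^ 3) (m : ℕ) :
    (S.filter (fun p => energyGap k p = m)).card ≤ 18 * T * m := by
  have hmaps : ∀ p ∈ S.filter (fun p => energyGap k p = m),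
      ∑ i, p i ^ 2 ∈ Finset.Ioc ⌊kF ^ 2⌋ (⌊kF ^ 2⌋ + m) := by
    intro p hp
    rw [Finset.mem_filter] at hp
    obtain ⟨h1, h2⟩ := hS p hp.1
    have hg := cast_energyGap k p
    rw [hp.2] at hg
    have hp2 : kF ^ 2 < ((∑ i, p i ^ 2 : ℤ) : ℝ) := by
      rw [← znorm_sq]
      exact pow_lt_pow_left₀ h1 hkF two_ne_zero
    have hq2 : znorm (p - k) ^ 2 ≤ kF ^ 2 :=
      pow_le_pow_left₀ (Real.sqrt_nonneg _) h2 2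
    rw [Finset.mem_Ioc]
    constructor
    · exact Int.floor_lt.2 hp2
    · rw [← sub_le_iff_le_add, Int.le_floor]
      push_cast at hg ⊢
      have := znorm_sq p
      push_cast at this
      linarith
  have hfib : ∀ n ∈ Finset.Ioc ⌊kF ^ 2⌋ (⌊kF ^ 2⌋ + m),
      ((S.filter (fun p => energyGap k p = m)).filter (fun p => ∑ i, p i ^ 2 = n)).card
        ≤ 18 * T := by
    intro n _
    rcases Finset.eq_empty_or_nonempty
      ((S.filter (fun p => energyGap k p = m)).filter (fun p => ∑ i, p i ^ 2 = n)) with h | ⟨q, hq⟩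
    · simp [h]
    · have hq' := hq
      simp only [Finset.mem_filter] at hq'
      refine card_plane_section_sphere_le k hk n (∑ i, q i * k i) T hT
        (hq'.2 ▸ hST q hq'.1.1) _ fun p hp => ?_
      simp only [Finset.mem_filter] at hp
      refine ⟨hp.2, ?_⟩
      have h1 := two_mul_dot_eq k p
      have h2 := two_mul_dot_eq k q
      rw [hp.1.2] at h1
      rw [hq'.1.2] at h2
      omega
  have h := Finset.card_le_mul_card_image_of_maps_to hmaps (18 * T) hfib
  simpa using h

/-- There is `C > 0` such that for every `k_F ≥ 2` and every
`k ∈ ℤ³` with `0 < |k| < 2k_F`, `D₂(k, k_F) ≤ C k_F^{2/3} (ln k_F) |k|⁴`. -/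
theorem D2_upper_bound :
    ∃ C : ℝ, 0 < C ∧ ∀ kF : ℝ, 2 ≤ kF → ∀ k : Fin 3 → ℤ,
      0 < znorm k → znorm k < 2 * kF →
      Dsum 2 kF k ≤ C * kF ^ ((2 : ℝ)/3) * Real.log kF * (znorm k) ^ 4 := by
  classical
  refine ⟨720, by norm_num, fun kF hkF k hk0 hk2 => ?_⟩
  have hkF0 : 0 < kF := by linarith
  have hkpos : 0 < ∑ i, k i ^ 2 := by
    have : (0 : ℝ) < ((∑ i, k i ^ 2 : ℤ) : ℝ) := by rw [← znorm_sq]; positivity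
    exact_mod_cast this
  have hk1 : 1 ≤ znorm k ^ 2 := by
    rw [znorm_sq]; exact_mod_cast hkpos
  set N : ℤ := ⌊9 * kF ^ 2⌋ with hN
  have hnorm : ∀ p ∈ lune kF k, ∑ i, p i ^ 2 ≤ N := by
    intro p hp
    rw [hN, Int.le_floor, ← znorm_sq]
    have h1 : znorm p ≤ 3 * kF := by
      have := znorm_le_add p k
      have := hp.2
      linarith
    have h0 : 0 ≤ znorm p := Real.sqrt_nonneg _
    nlinarith
  have hgap : ∀ p ∈ lune kF k, 0 < energyGap k p := by
    intro p hp
    have : (0 : ℝ) < energyGap k p := by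
      rw [cast_energyGap]
      have h1 := hp.1
      have h2 := hp.2
      have h0 : 0 ≤ znorm (p - k) := Real.sqrt_nonneg _
      nlinarith
    exact_mod_cast this
  set S : Finset (Fin 3 → ℤ) :=
    (Fintype.piFinset fun _ => Finset.Icc (-N) N).filter (· ∈ lune kF k) with hS
  have hmemS : ∀ p, p ∈ S ↔ p ∈ lune kF k := by
    intro p
    refine ⟨fun h => (Finset.mem_filter.1 h).2, fun h => Finset.mem_filter.2 ⟨?_, h⟩⟩
    rw [Fintype.mem_piFinset]
    intro i
    have h1 : p i ^ 2 ≤ ∑ i, p i ^ 2 :=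
      Finset.single_le_sum (f := fun i => p i ^ 2) (fun _ _ => sq_nonneg _) (Finset.mem_univ i)
    have h2 := h1.trans (hnorm p h)
    rw [Finset.mem_Icc]
    constructor <;> nlinarith [Int.le_self_sq (p i), Int.le_self_sq (-p i)]
  have hsum : Dsum 2 kF k = ∑ p ∈ S, ((energyGap k p : ℝ) ^ 2)⁻¹ := by
    rw [Dsum, tsum_eq_sum (s := S) fun p hp => if_neg fun h => hp ((hmemS p).2 h)]
    refine Finset.sum_congr rfl fun p hp => ?_
    have hp' := (hmemS p).1 hp
    have hpos : (0 : ℝ) < energyGap k p := by exact_mod_cast hgap p hp'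
    rw [if_pos hp', ← cast_energyGap, Real.rpow_neg hpos.le]
    norm_cast
  set x : ℝ := kF ^ ((2 : ℝ) / 3) with hx
  have hx1 : 1 ≤ x := Real.one_le_rpow (by linarith) (by norm_num)
  have hx3 : x ^ 3 = kF ^ 2 := by
    rw [hx, ← Real.rpow_natCast, ← Real.rpow_mul hkF0.le, ← Real.rpow_natCast]
    norm_num
  set T : ℕ := ⌈4 * x⌉₊ with hT
  have hTx : 4 * x ≤ T := Nat.le_ceil _
  have hTx' : (T : ℝ) ≤ 5 * x := by
    have := Nat.ceil_lt_add_one (a := 4 * x) (by linarith)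
    linarith
  have hT0 : 0 < T := Nat.ceil_pos.2 (by linarith)
  have hNT : N < (T : ℤ) ^ 3 := by
    have h1 : (N : ℝ) ≤ 9 * kF ^ 2 := Int.floor_le _
    have h2 : (4 * x) ^ 3 ≤ (T : ℝ) ^ 3 := pow_le_pow_left₀ (by linarith) hTx 3
    have h3 : (N : ℝ) < (T : ℝ) ^ 3 := by
      rw [mul_pow, hx3] at h2
      nlinarith
    exact_mod_cast h3
  have hfiber := card_energyGap_fiber_le kF k hkpos T hT0 S hkF0.le (fun p hp => (hmemS p).1 hp)
    (fun p hp => (hnorm p ((hmemS p).1 hp)).trans_lt hNT)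
  have hmaps : ∀ p ∈ S, (energyGap k p).toNat ∈ Finset.Icc 1 N.toNat := by
    intro p hp
    have h1 := hgap p ((hmemS p).1 hp)
    have h2 := hnorm p ((hmemS p).1 hp)
    have h3 : energyGap k p ≤ ∑ i, p i ^ 2 := by
      rw [energyGap]
      exact sub_le_self _ (Finset.sum_nonneg fun _ _ => sq_nonneg _)
    rw [Finset.mem_Icc]
    omega
  have hN0 : 0 < N := by
    rw [hN, Int.floor_pos]
    nlinarith
  have hharm : ∑ p ∈ S, ((energyGap k p : ℝ) ^ 2)⁻¹ ≤ 18 * T * (harmonic N.toNat : ℝ) := by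
    rw [← Finset.sum_fiberwise_of_maps_to hmaps, harmonic_eq_sum_Icc]
    push_cast
    rw [Finset.mul_sum]
    refine Finset.sum_le_sum fun m hm => ?_
    have hm1 : 1 ≤ m := (Finset.mem_Icc.1 hm).1
    have hmR : (0 : ℝ) < m := by exact_mod_cast hm1
    have hfilter : S.filter (fun p => (energyGap k p).toNat = m)
        = S.filter (fun p => energyGap k p = m) :=
      Finset.filter_congr fun p _ => by omega
    rw [hfilter, Finset.sum_congr rfl (g := fun _ => ((m : ℝ) ^ 2)⁻¹) fun p hp => by
      rw [(Finset.mem_filter.1 hp).2]; norm_cast, Finset.sum_const, nsmul_eq_mul]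
    have hc : ((S.filter (fun p => energyGap k p = m)).card : ℝ) ≤ 18 * T * m := by
      exact_mod_cast hfiber m
    calc _ ≤ 18 * T * (m : ℝ) * ((m : ℝ) ^ 2)⁻¹ := by gcongr
      _ = 18 * T * (m : ℝ)⁻¹ := by field_simp
  have hlog2 : 1 / 2 ≤ Real.log kF := by
    have := Real.log_le_log (by norm_num) hkF
    have := Real.log_two_gt_d9
    linarith
  have hlog : (harmonic N.toNat : ℝ) ≤ 8 * Real.log kF := by
    refine (harmonic_le_one_add_log _).trans ?_
    have hNr : ((N.toNat : ℕ) : ℝ) = (N : ℝ) := by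
      exact_mod_cast congrArg (Int.cast (R := ℝ)) (Int.toNat_of_nonneg hN0.le)
    have h1 : (N : ℝ) ≤ kF ^ 6 := by
      have h2 : (N : ℝ) ≤ 9 * kF ^ 2 := Int.floor_le _
      have h3 : (2 : ℝ) ^ 4 ≤ kF ^ 4 := pow_le_pow_left₀ (by norm_num) hkF 4
      nlinarith [sq_nonneg kF]
    have h2 : Real.log N ≤ 6 * Real.log kF := by
      have := Real.log_le_log (by exact_mod_cast hN0) h1
      rw [Real.log_pow] at this
      exact_mod_cast this
    rw [hNr]
    linarith
  have hk4 : 1 ≤ znorm k ^ 4 := by nlinarith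
  calc Dsum 2 kF k ≤ 18 * T * (harmonic N.toNat : ℝ) := hsum ▸ hharm
    _ ≤ 18 * (5 * x) * (8 * Real.log kF) := by
      refine (mul_le_mul_of_nonneg_left hlog (by positivity)).trans ?_
      gcongr
    _ = 720 * x * Real.log kF := by ring
    _ ≤ 720 * x * Real.log kF * znorm k ^ 4 :=
      le_mul_of_one_le_right (by positivity) hk4
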